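/- Let H and H′ be N×N real symmetric (or complex Hermitian) matrices and let f : ℝ → ℝ be Lipschitz with Lipschitz constant Lip(f). Then Tr( (f(H) − f(H′))² ) ≤ Lip(f)² · Tr( (H − H′)² ), where f(H) denotes the matrix obtained by applying f to H spectrally (i.e., f applied to the eigenvalues in a spectral decomposition). -/

import Mathlib

open MeasureTheory ProbabilityTheory Matrix Filter Kronecker
open scoped ComplexOrder

noncomputable section

/-- The matrix `f(H)` obtained by applying `f : ℝ → ℝ` spectrally to a Hermitian
matrix `H`. -/
def hermFun {n : Type*} [Fintype n] [DecidableEq n] {H : Matrix n n ℂ}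
    (hH : H.IsHermitian) (f : ℝ → ℝ) : Matrix n n ℂ :=
  (hH.eigenvectorUnitary : Matrix n n ℂ)
    * Matrix.diagonal (fun i => (f (hH.eigenvalues i) : ℂ))
    * star (hH.eigenvectorUnitary : Matrix n n ℂ)

/-- The squared Frobenius distance between `U D U*` and `V E V*` in terms of the entries of the
overlap matrix `U* V`. -/
theorem trace_sq_conj_diagonal_sub_conj_diagonal {n : Type*} [Fintype n] [DecidableEq n]
    (U V : Matrix.unitaryGroup n ℂ) (d e : n → ℝ) (X : Matrix n n ℂ)
    (hX : X = (U : Matrix n n ℂ) * Matrix.diagonal (fun i => (d i : ℂ)) * star (U : Matrix n n ℂ)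
      - (V : Matrix n n ℂ) * Matrix.diagonal (fun i => (e i : ℂ)) * star (V : Matrix n n ℂ)) :
    ((X * X).trace).re = ∑ i, ∑ j, (d i - e j) ^ 2 *
      Complex.normSq ((star (U : Matrix n n ℂ) * (V : Matrix n n ℂ)) i j) := by
  have hU : star (U : Matrix n n ℂ) * U = 1 := Unitary.coe_star_mul_self U
  have hU' : (U : Matrix n n ℂ) * star (U : Matrix n n ℂ) = 1 := Unitary.coe_mul_star_self U
  have hV : star (V : Matrix n n ℂ) * V = 1 := Unitary.coe_star_mul_self V
  have hV' : (V : Matrix n n ℂ) * star (V : Matrix n n ℂ) = 1 := Unitary.coe_mul_star_self V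
  have diagonal_star (a : n → ℝ) :
      star (Matrix.diagonal (fun i => (a i : ℂ))) = Matrix.diagonal (fun i => (a i : ℂ)) := by
    rw [Matrix.star_eq_conjTranspose, Matrix.diagonal_conjTranspose]
    congr 1
    ext i
    simp
  have hXs : star X = X := by
    simp only [hX, star_sub, star_mul, star_star, diagonal_star, mul_assoc]
  set W := star (U : Matrix n n ℂ) * (V : Matrix n n ℂ) with hW
  set M := star (U : Matrix n n ℂ) * X * (V : Matrix n n ℂ) with hM
  have hMW : M = Matrix.diagonal (fun i => (d i : ℂ)) * W
      - W * Matrix.diagonal (fun i => (e i : ℂ)) := by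
    rw [hM, hX, hW, mul_sub, sub_mul]
    congr 1
    · simp only [← mul_assoc, hU, one_mul]
    · simp only [mul_assoc, hV, mul_one]
  have htrace : (X * X).trace = (M * star M).trace := by
    have : M * star M = star (U : Matrix n n ℂ) * (X * X) * U := by
      simp only [hM, star_mul, star_star, hXs, mul_assoc]
      rw [← mul_assoc (V : Matrix n n ℂ), hV', one_mul]
    rw [this, Matrix.trace_mul_cycle, hU', one_mul]
  rw [htrace, Matrix.trace, Complex.re_sum]
  refine Finset.sum_congr rfl fun i _ => ?_
  rw [Matrix.diag_apply, Matrix.mul_apply, Complex.re_sum]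
  refine Finset.sum_congr rfl fun j _ => ?_
  have hMij : M i j = ((d i - e j : ℝ) : ℂ) * W i j := by
    rw [hMW, Matrix.sub_apply, Matrix.diagonal_mul, Matrix.mul_diagonal]
    push_cast
    ring
  rw [Matrix.star_apply, Complex.star_def, Complex.mul_conj, Complex.ofReal_re, hMij,
    Complex.normSq_mul, Complex.normSq_ofReal, sq]

/-- **Lipschitz functional calculus bound.** For Hermitian matrices `H, H'` and a
Lipschitz function `f` with constant `c`,
`Tr((f(H) - f(H'))²) ≤ c² Tr((H - H')²)`. -/
theorem trace_sq_hermFun_le {n : Type*} [Fintype n] [DecidableEq n]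
    (H H' : Matrix n n ℂ) (hH : H.IsHermitian) (hH' : H'.IsHermitian)
    (f : ℝ → ℝ) (c : NNReal) (hf : LipschitzWith c f) :
    (((hermFun hH f - hermFun hH' f) * (hermFun hH f - hermFun hH' f)).trace).re
      ≤ (c : ℝ) ^ 2 * (((H - H') * (H - H')).trace).re := by
  rw [trace_sq_conj_diagonal_sub_conj_diagonal hH.eigenvectorUnitary hH'.eigenvectorUnitary
      (f ∘ hH.eigenvalues) (f ∘ hH'.eigenvalues) (hermFun hH f - hermFun hH' f) rfl,
    trace_sq_conj_diagonal_sub_conj_diagonal hH.eigenvectorUnitary hH'.eigenvectorUnitary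
      hH.eigenvalues hH'.eigenvalues (H - H')
      (congrArg₂ _ hH.spectral_theorem hH'.spectral_theorem),
    Finset.mul_sum]
  refine Finset.sum_le_sum fun i _ => ?_
  rw [Finset.mul_sum]
  refine Finset.sum_le_sum fun j _ => ?_
  rw [← mul_assoc, ← mul_pow]
  refine mul_le_mul_of_nonneg_right (sq_le_sq.mpr ?_) (Complex.normSq_nonneg _)
  rw [abs_mul, NNReal.abs_eq]
  simpa only [Real.dist_eq, Function.comp_apply] using hf.dist_le_mul (hH.eigenvalues i) (hH'.eigenvalues j)

end
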